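/- arXiv:2511.08333 — 2 statements merged into one kernel-verified Lean document; each statement's English description precedes it below -/
import Mathlib

section
/- Let e ≥ 3 and n ∈ ℕ. Then the number of distinct tuples (a₂ mod 2^e, ..., a_e mod 2^e), where Σ a_i x^{n-i} ranges over characteristic polynomials of symmetric n×n {±1}-matrices with unit diagonal, is at most 2^{binom(e-2,2)} if n is even and at most 2^{binom(e-2,2)+1} if n is odd. -/
open Matrix

theorem two_dvd_det_odd {R ι : Type*} [CommRing R] [Fintype ι] [DecidableEq ι]
    (S : Matrix ι ι R) (hs : Sᵀ = S) (hd : ∀ i, (2 : R) ∣ S i i) (hc : Odd (Fintype.card ι)) :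
    (2 : R) ∣ S.det := by
  rw [← Ideal.mem_span_singleton, ← Ideal.Quotient.eq_zero_iff_mem, RingHom.map_det, det_apply]
  set f := Ideal.Quotient.mk (Ideal.span {(2 : R)}) with hf
  have h2 : (2 : R ⧸ Ideal.span {(2 : R)}) = 0 := by
    have : f 2 = 0 := Ideal.Quotient.eq_zero_iff_mem.2 (Ideal.mem_span_singleton_self _)
    rw [← map_ofNat f 2]; exact this
  have hsymm : ∀ i j, S i j = S j i := fun i j => by
    conv_lhs => rw [← hs]
    rfl
  have hinv : ∀ σ : Equiv.Perm ι, ∏ i, f (S (σ⁻¹ i) i) = ∏ i, f (S (σ i) i) := by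
    intro σ
    rw [← Equiv.prod_comp σ (fun i => f (S (σ⁻¹ i) i))]
    refine Finset.prod_congr rfl fun i _ => ?_
    simp [hsymm i]
  refine Finset.sum_involution (fun σ _ => σ⁻¹) ?_ ?_ (fun _ _ => Finset.mem_univ _) (fun _ _ => inv_inv _)
  · intro σ _
    have := hinv σ
    simp only [RingHom.mapMatrix_apply, map_apply, Equiv.Perm.sign_inv] at *
    rw [this, ← two_smul (R ⧸ Ideal.span {(2 : R)}), h2, zero_smul]
  · intro σ _ hne heq
    apply hne
    have h1 : σ ^ 2 ^ 1 = 1 := by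
      rw [pow_one, pow_two]
      nth_rewrite 1 [← heq]
      simp
    obtain ⟨a, ha⟩ := Equiv.Perm.exists_fixed_point_of_prime (p := 2) (n := 1)
      (by rw [← even_iff_two_dvd, Nat.not_even_iff_odd]; exact hc) h1
    rw [Finset.prod_eq_zero (Finset.mem_univ a), smul_zero]
    simp only [RingHom.mapMatrix_apply, map_apply, ha]
    exact Ideal.Quotient.eq_zero_iff_mem.2 (Ideal.mem_span_singleton.2 (hd a))

theorem two_dvd_det_col {R ι : Type*} [CommRing R] [Fintype ι] [DecidableEq ι]
    (S : Matrix ι ι R) (k : ι) (hd : ∀ i, (2 : R) ∣ S i k) : (2 : R) ∣ S.det := by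
  rw [det_apply]
  refine Finset.dvd_sum fun σ _ => ?_
  rw [Units.smul_def, zsmul_eq_mul]
  exact Dvd.dvd.mul_left ((hd (σ k)).trans (Finset.dvd_prod_of_mem (fun i => S (σ i) i) (Finset.mem_univ k))) _

theorem four_dvd_det_row {R : Type*} [CommRing R] {m : ℕ} (hm : Odd m)
    (S : Matrix (Fin (m + 1)) (Fin (m + 1)) R) (hs : Sᵀ = S) (hd : ∀ i, (2 : R) ∣ S i i)
    (h0 : ∀ j, (2 : R) ∣ S 0 j) : (4 : R) ∣ S.det := by
  have h4 : (4 : R) = 2 * 2 := by norm_num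
  have hsymm : ∀ i j, S i j = S j i := fun i j => by
    conv_lhs => rw [← hs]
    rfl
  rw [det_succ_row_zero, h4]
  refine Finset.dvd_sum fun j _ => mul_dvd_mul (Dvd.dvd.mul_left (h0 j) _) ?_
  rcases Fin.eq_zero_or_eq_succ j with rfl | ⟨k, rfl⟩
  · apply two_dvd_det_odd
    · ext a b
      simp [hsymm (Fin.succ b)]
    · intro i
      simpa using hd _
    · simpa using hm
  · obtain ⟨m', rfl⟩ : ∃ m', m = m' + 1 := ⟨m - 1, by have := hm.pos; omega⟩
    apply two_dvd_det_col _ 0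
    intro i
    simp only [submatrix_apply]
    rw [Fin.succ_succAbove_zero, hsymm]
    exact h0 _

theorem det_pivot {R : Type*} [CommRing R] {m : ℕ} (P : Matrix (Fin 2) (Fin 2) R)
    (B : Matrix (Fin 2) (Fin m) R) (C : Matrix (Fin m) (Fin 2) R) (D : Matrix (Fin m) (Fin m) R) :
    (fromBlocks P B C D).det * P.det ^ m = P.det * (P.det • D - C * P.adjugate * B).det := by
  have h : fromBlocks P B C D * fromBlocks 1 (-(P.adjugate * B)) 0 (P.det • 1)
      = fromBlocks P 0 C (P.det • D - C * P.adjugate * B) := by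
    rw [fromBlocks_multiply]
    congr 1
    · simp
    · rw [Matrix.mul_neg, ← Matrix.mul_assoc, mul_adjugate]; simp
    · simp
    · rw [Matrix.mul_neg, ← Matrix.mul_assoc]
      simp [sub_eq_add_neg, add_comm]
  have := congrArg det h
  rw [det_mul, det_fromBlocks_zero₂₁, det_fromBlocks_zero₁₂] at this
  simpa using this

theorem exists_pivot_equiv (r : ℕ) (j : Fin (2 * r + 2)) (hj : j ≠ 0) :
    ∃ e : Fin 2 ⊕ Fin (2 * r) ≃ Fin (2 * r + 2), e (Sum.inl 0) = 0 ∧ e (Sum.inl 1) = j := by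
  refine ⟨(finSumFinEquiv.trans (finCongr (by omega))).trans (Equiv.swap 1 j), ?_, ?_⟩
  · have : ((finSumFinEquiv.trans (finCongr (by omega)) : Fin 2 ⊕ Fin (2 * r) ≃ Fin (2 * r + 2))
      (Sum.inl 0)) = 0 := by ext; simp
    rw [Equiv.trans_apply, this, Equiv.swap_apply_of_ne_of_ne (by simp) hj.symm]
  · have : ((finSumFinEquiv.trans (finCongr (by omega)) : Fin 2 ⊕ Fin (2 * r) ≃ Fin (2 * r + 2))
      (Sum.inl 1)) = 1 := by ext; simp
    rw [Equiv.trans_apply, this, Equiv.swap_apply_left]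

theorem det_even_sq {R : Type*} [CommRing R] (hp : Prime (2 : R)) : ∀ (r : ℕ)
    (S : Matrix (Fin (2 * r)) (Fin (2 * r)) R), Sᵀ = S → (∀ i, (2 : R) ∣ S i i) →
    ∃ h f : R, ¬ (2 : R) ∣ h ∧ (4 : R) ∣ h ^ 2 * S.det - (-1) ^ r * f ^ 2 := by
  intro r
  induction r with
  | zero =>
    intro S _ _
    exact ⟨1, 1, fun h => hp.not_isUnit (isUnit_of_dvd_one h), by simp⟩
  | succ r ih =>
    intro S hs hd
    have hsymm : ∀ i j, S i j = S j i := fun i j => by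
      conv_lhs => rw [← hs]
      rfl
    by_cases h0 : ∀ j, (2 : R) ∣ S (0 : Fin (2 * r + 1 + 1)) j
    · refine ⟨1, 0, fun h => hp.not_isUnit (isUnit_of_dvd_one h), ?_⟩
      have := four_dvd_det_row (m := 2 * r + 1) (by simp) S hs hd h0
      simpa using this
    · push Not at h0
      obtain ⟨j, hj⟩ := h0
      obtain ⟨e, he0, he1⟩ := exists_pivot_equiv r j (by rintro rfl; exact hj (hd _))
      set S1 := S.submatrix e e with hS1
      have hs1 : ∀ i j, S1 i j = S1 j i := fun i j => hsymm _ _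
      have hd1 : ∀ i, (2 : R) ∣ S1 i i := fun i => hd _
      have hb : ¬ (2 : R) ∣ S1 (Sum.inl 0) (Sum.inl 1) := by
        simpa [hS1, he0, he1] using hj
      have hdet : S1.det = S.det := det_submatrix_equiv_self e S
      obtain ⟨a, ha⟩ := hd1 (Sum.inl 0)
      obtain ⟨c, hc⟩ := hd1 (Sum.inl 1)
      set b := S1 (Sum.inl 0) (Sum.inl 1) with hbdef
      set P := S1.toBlocks₁₁ with hP
      have hP00 : P 0 0 = 2 * a := ha
      have hP11 : P 1 1 = 2 * c := hc
      have hP01 : P 0 1 = b := rfl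
      have hP10 : P 1 0 = b := hs1 _ _
      have hPdet : P.det = 4 * (a * c) - b ^ 2 := by
        rw [det_fin_two, hP00, hP11, hP01, hP10]; ring
      have hpiv := det_pivot P S1.toBlocks₁₂ S1.toBlocks₂₁ S1.toBlocks₂₂
      rw [hP, fromBlocks_toBlocks, ← hP, hdet] at hpiv
      set S2 := P.det • S1.toBlocks₂₂ - S1.toBlocks₂₁ * P.adjugate * S1.toBlocks₁₂ with hS2
      have hent : ∀ i j, S2 i j = P.det * S1 (Sum.inr i) (Sum.inr j)
          - (2 * c * (S1 (Sum.inr i) (Sum.inl 0) * S1 (Sum.inl 0) (Sum.inr j))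
            - b * (S1 (Sum.inr i) (Sum.inl 0) * S1 (Sum.inl 1) (Sum.inr j))
            - b * (S1 (Sum.inr i) (Sum.inl 1) * S1 (Sum.inl 0) (Sum.inr j))
            + 2 * a * (S1 (Sum.inr i) (Sum.inl 1) * S1 (Sum.inl 1) (Sum.inr j))) := by
        intro i j
        simp only [hS2, Matrix.sub_apply, Matrix.smul_apply, smul_eq_mul, Matrix.mul_apply,
          Fin.sum_univ_two, adjugate_fin_two, hP00, hP11, hP01, hP10]
        simp [toBlocks₂₂, toBlocks₂₁, toBlocks₁₂]
        ring
      obtain ⟨h, f, hh, hf⟩ := ih S2 (by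
          ext i j
          rw [transpose_apply, hent, hent, hs1 (Sum.inr j) (Sum.inr i), hs1 (Sum.inr j) (Sum.inl 0),
            hs1 (Sum.inr j) (Sum.inl 1), hs1 (Sum.inr i) (Sum.inl 0), hs1 (Sum.inr i) (Sum.inl 1)]
          ring) (by
          intro i
          obtain ⟨w, hw⟩ := hd1 (Sum.inr i)
          rw [hent, hw, hs1 (Sum.inr i) (Sum.inl 0), hs1 (Sum.inr i) (Sum.inl 1)]
          set u := S1 (Sum.inl 0) (Sum.inr i)
          set v := S1 (Sum.inl 1) (Sum.inr i)
          exact ⟨P.det * w - (c * (u * u) - b * (u * v) + a * (v * v)), by ring⟩)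
      have hδ : ¬ (2 : R) ∣ P.det := by
        rw [hPdet]
        intro hdv
        have : (2 : R) ∣ b ^ 2 := by
          have h1 : (2 : R) ∣ 4 * (a * c) := ⟨2 * (a * c), by ring⟩
          simpa using dvd_sub h1 hdv
        exact hb (hp.dvd_of_dvd_pow this)
      refine ⟨h * P.det ^ r, b * f, fun hdv => ?_, ?_⟩
      · rcases hp.dvd_or_dvd hdv with h' | h'
        · exact hh h'
        · exact hδ (hp.dvd_of_dvd_pow h')
      · obtain ⟨k, hk⟩ := hf
        refine ⟨P.det * k + a * c * ((-1) ^ r * f ^ 2), ?_⟩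
        have e1 : (h * P.det ^ r) ^ 2 * S.det = h ^ 2 * (P.det * S2.det) := by
          rw [← hpiv]; ring
        rw [e1]
        have e2 : h ^ 2 * S2.det = 4 * k + (-1) ^ r * f ^ 2 := by rw [← hk]; ring
        calc _ = P.det * (h ^ 2 * S2.det) + (-1) ^ r * b ^ 2 * f ^ 2 := by ring
          _ = _ := by rw [e2]; nth_rewrite 1 [show P.det = P.det from rfl]; rw [hPdet]; ring


theorem prime_two_poly : Prime (2 : Polynomial ℤ) := by
  have := Polynomial.prime_C_iff.2 Int.prime_two
  simpa using this

theorem two_dvd_iff_map (p : Polynomial ℤ) :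
    (2 : Polynomial ℤ) ∣ p ↔ p.map (Int.castRingHom (ZMod 2)) = 0 := by
  have : (2 : Polynomial ℤ) = Polynomial.C 2 := by simp
  rw [this, Polynomial.C_dvd_iff_dvd_coeff, Polynomial.ext_iff]
  refine forall_congr' fun i => ?_
  rw [Polynomial.coeff_map, Polynomial.coeff_zero, eq_intCast, ZMod.intCast_zmod_eq_zero_iff_dvd]
  rfl

theorem exists_sqrt (g h f : Polynomial ℤ) (r : ℕ) (hh : ¬ (2 : Polynomial ℤ) ∣ h)
    (hf : (4 : Polynomial ℤ) ∣ h ^ 2 * g - (-1) ^ r * f ^ 2) :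
    ∃ q : Polynomial ℤ, (4 : Polynomial ℤ) ∣ g - (-1) ^ r * q ^ 2 := by
  have h4 : (4 : Polynomial ℤ) = 2 ^ 2 := by norm_num
  have hdv : (2 : Polynomial ℤ) ∣ h ^ 2 * g - f ^ 2 := by
    obtain ⟨k, hk⟩ := hf
    rcases neg_one_pow_eq_or (Polynomial ℤ) r with e | e
    · rw [e] at hk
      exact ⟨2 * k, by linear_combination hk⟩
    · rw [e] at hk
      exact ⟨2 * k - f ^ 2, by linear_combination hk⟩
  rw [two_dvd_iff_map] at hdv
  simp only [Polynomial.map_sub, Polynomial.map_mul, Polynomial.map_pow] at hdv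
  set φ := Int.castRingHom (ZMod 2)
  have hd2 : h.map φ ^ 2 ∣ f.map φ ^ 2 := ⟨g.map φ, (sub_eq_zero.1 hdv).symm⟩
  obtain ⟨s, hs⟩ := (IsIntegrallyClosed.pow_dvd_pow_iff (n := 2) (by norm_num)).1 hd2
  obtain ⟨q, rfl⟩ := Polynomial.map_surjective φ (ZMod.ringHom_surjective φ) s
  have hk : (2 : Polynomial ℤ) ∣ f - h * q := by
    rw [two_dvd_iff_map, Polynomial.map_sub, Polynomial.map_mul, hs, sub_self]
  obtain ⟨k, hk⟩ := hk
  refine ⟨q, ?_⟩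
  rw [h4]
  refine prime_two_poly.pow_dvd_of_dvd_mul_left 2 (a := h ^ 2)
    (fun hx => hh (prime_two_poly.dvd_of_dvd_pow hx)) ?_
  obtain ⟨w, hw⟩ := hf
  have hfe : f = h * q + 2 * k := by linear_combination hk
  rw [hfe] at hw
  exact ⟨w + (-1) ^ r * (h * q * k + k ^ 2), by linear_combination hw⟩

theorem exists_reduce (p : Polynomial ℤ) :
    ∃ p0 p1 : Polynomial ℤ, p = p0 + 2 * p1 ∧ (p0 = 0 ∨ Odd p0.leadingCoeff) := by
  induction hn : p.natDegree using Nat.strong_induction_on generalizing p with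
  | _ n ih =>
    by_cases hp : p = 0
    · exact ⟨0, 0, by simp [hp], Or.inl rfl⟩
    by_cases hodd : Odd p.leadingCoeff
    · exact ⟨p, 0, by simp, Or.inr hodd⟩
    rw [Int.not_odd_iff_even] at hodd
    obtain ⟨k, hk⟩ := hodd
    have hpe := p.eraseLead_add_monomial_natDegree_leadingCoeff
    have hmon : Polynomial.monomial p.natDegree p.leadingCoeff
        = 2 * Polynomial.monomial p.natDegree k := by
      rw [hk, map_add, two_mul]
    by_cases h0 : p.natDegree = 0
    · refine ⟨0, Polynomial.monomial p.natDegree k, ?_, Or.inl rfl⟩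
      rw [← hmon, zero_add]
      conv_lhs => rw [← hpe]
      have : p.eraseLead = 0 := by
        rw [Polynomial.eq_C_of_natDegree_eq_zero h0, Polynomial.eraseLead_C]
      rw [this, zero_add]
    · have hlt : p.eraseLead.natDegree < n := by
        have := p.eraseLead_natDegree_le
        omega
      obtain ⟨p0, p1, h1, h2⟩ := ih _ hlt p.eraseLead rfl
      refine ⟨p0, p1 + Polynomial.monomial p.natDegree k, ?_, h2⟩
      rw [mul_add, ← hmon, ← add_assoc, ← h1, hpe]

theorem coeff_dvd_of_dvd {c : ℤ} {p : Polynomial ℤ} (h : Polynomial.C c ∣ p) (i : ℕ) :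
    c ∣ p.coeff i := (Polynomial.C_dvd_iff_dvd_coeff c p).1 h i

theorem poly_key (T T' q q' : Polynomial ℤ) (r n t : ℕ)
    (hT : (4 : Polynomial ℤ) ∣ T - (2 * Polynomial.X - 1) * ((-1) ^ r * q ^ 2))
    (hT' : (4 : Polynomial ℤ) ∣ T' - (2 * Polynomial.X - 1) * ((-1) ^ r * q' ^ 2))
    (hlead : Odd (T'.coeff (n - 1))) (hhigh : ∀ j, n ≤ j → (2 : ℤ) ∣ T'.coeff j)
    (ht : t + 4 ≤ n) (hag : ∀ j, t < j → (4 : ℤ) ∣ T.coeff j - T'.coeff j) :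
    (2 : ℤ) ∣ T.coeff t - T'.coeff t := by
  obtain ⟨d0, d1, hd, hd0⟩ := exists_reduce (q - q')
  obtain ⟨q0, q1, hq, hq0⟩ := exists_reduce q'
  obtain ⟨u, hu⟩ := hT
  obtain ⟨u', hu'⟩ := hT'
  set ε : Polynomial ℤ := (-1) ^ r with hε
  have hεε : ε * ε = 1 := by rw [hε, ← mul_pow]; simp
  have hε2 : ∃ w, ε = 1 + 2 * w := by
    rcases neg_one_pow_eq_or (Polynomial ℤ) r with e | e
    · exact ⟨0, by rw [hε, e]; ring⟩
    · exact ⟨-1, by rw [hε, e]; ring⟩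
  obtain ⟨w, hw⟩ := hε2
  have hqd : q = q0 + 2 * q1 + d0 + 2 * d1 := by linear_combination hd + hq
  have C2 : (2 : Polynomial ℤ) = Polynomial.C 2 := by simp
  have C4 : (4 : Polynomial ℤ) = Polynomial.C 4 := by simp
  -- parity of the coefficients
  have hpar' : ∀ j, (2 : ℤ) ∣ T'.coeff j - (q0 ^ 2).coeff j := by
    intro j
    rw [← Polynomial.coeff_sub]
    apply coeff_dvd_of_dvd
    rw [← C2]
    refine ⟨2 * u' + (Polynomial.X - 1) * ε * q' ^ 2 + w * q' ^ 2 + 2 * q0 * q1 + 2 * q1 ^ 2, ?_⟩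
    have hT'e : T' = (2 * Polynomial.X - 1) * (ε * q' ^ 2) + 4 * u' := by linear_combination hu'
    rw [hT'e, hw, hq]; ring
  have hpar : ∀ j, (2 : ℤ) ∣ (T.coeff j - T'.coeff j) - (d0 ^ 2).coeff j := by
    intro j
    rw [← Polynomial.coeff_sub, ← Polynomial.coeff_sub]
    apply coeff_dvd_of_dvd
    rw [← C2]
    refine ⟨2 * u - 2 * u' + (Polynomial.X - 1) * ε * (q ^ 2 - q' ^ 2) + w * (q ^ 2 - q' ^ 2)
      + (q0 + 2 * q1) * (d0 + 2 * d1) + 2 * d0 * d1 + 2 * d1 ^ 2, ?_⟩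
    have hTe : T = (2 * Polynomial.X - 1) * (ε * q ^ 2) + 4 * u := by linear_combination hu
    have hT'e : T' = (2 * Polynomial.X - 1) * (ε * q' ^ 2) + 4 * u' := by linear_combination hu'
    rw [hTe, hT'e, hw, hqd, hq]; ring
  rcases hd0 with rfl | hd0
  · simpa using hpar t
  have hq0 : Odd q0.leadingCoeff := by
    rcases hq0 with rfl | h
    · exfalso
      have := hpar' (n - 1)
      simp at this
      rw [← Int.not_even_iff_odd, even_iff_two_dvd] at hlead
      exact hlead this
    · exact h
  have hsq : ∀ p : Polynomial ℤ, Odd p.leadingCoeff → ¬ (2 : ℤ) ∣ (p ^ 2).coeff (2 * p.natDegree) := by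
    intro p hp
    have e1 : (p ^ 2).coeff (2 * p.natDegree) = p.leadingCoeff ^ 2 := by
      rw [← Polynomial.leadingCoeff_pow, Polynomial.leadingCoeff, Polynomial.natDegree_pow]
    rw [e1, ← even_iff_two_dvd, Int.not_even_iff_odd]
    exact hp.pow
  have hsq0 : ∀ (p : Polynomial ℤ) j, 2 * p.natDegree < j → (p ^ 2).coeff j = 0 := by
    intro p j hj
    apply Polynomial.coeff_eq_zero_of_natDegree_lt
    rw [Polynomial.natDegree_pow]; exact hj
  set s := q0.natDegree with hs
  set k := d0.natDegree with hk
  have hs2 : 2 * s = n - 1 := by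
    apply le_antisymm
    · by_contra hlt
      have h1 := hhigh (2 * s) (by omega)
      have h2 := hpar' (2 * s)
      exact hsq q0 hq0 (by have := dvd_sub h1 h2; rwa [sub_sub_cancel] at this)
    · by_contra hlt
      have h2 := hpar' (n - 1)
      rw [hsq0 q0 (n - 1) (by omega), sub_zero] at h2
      rw [← Int.not_even_iff_odd, even_iff_two_dvd] at hlead
      exact hlead h2
  have hk2 : 2 * k ≤ t := by
    by_contra hlt
    have h1 : (2 : ℤ) ∣ T.coeff (2 * k) - T'.coeff (2 * k) :=
      Dvd.dvd.trans (by norm_num) (hag (2 * k) (by omega))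
    have h2 := hpar (2 * k)
    exact hsq d0 hd0 (by have := dvd_sub h1 h2; rwa [sub_sub_cancel] at this)
  rcases hk2.lt_or_eq with hlt | heq
  · have := hpar t
    rwa [hsq0 d0 t hlt, sub_zero] at this
  exfalso
  have hmain : (4 : ℤ) ∣ ((2 * Polynomial.X + 1) * (T - T') + ε * (d0 ^ 2 + 2 * (d0 * q0))).coeff (k + s) := by
    apply coeff_dvd_of_dvd
    rw [← C4]
    have hTe : T = (2 * Polynomial.X - 1) * (ε * q ^ 2) + 4 * u := by linear_combination hu
    have hT'e : T' = (2 * Polynomial.X - 1) * (ε * q' ^ 2) + 4 * u' := by linear_combination hu'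
    refine ⟨(2 * Polynomial.X + 1) * (u - u') + Polynomial.X ^ 2 * ε * (q ^ 2 - q' ^ 2)
      - ε * (d0 * d1 + d1 ^ 2 + d0 * q1 + d1 * q0 + 2 * d1 * q1), ?_⟩
    rw [hTe, hT'e, hqd, hq]; ring
  have e1 : ((2 * Polynomial.X + 1) * (T - T')).coeff (k + s)
      = 2 * (T.coeff (k + s - 1) - T'.coeff (k + s - 1)) + (T.coeff (k + s) - T'.coeff (k + s)) := by
    obtain ⟨z, hz⟩ : ∃ z, k + s = z + 1 := ⟨k + s - 1, by omega⟩
    rw [hz, add_mul, one_mul, mul_assoc, C2, Polynomial.coeff_add, Polynomial.coeff_C_mul,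
      Polynomial.coeff_X_mul]
    simp
  have e2 : (ε * (d0 ^ 2 + 2 * (d0 * q0))).coeff (k + s)
      = (-1) ^ r * (2 * (d0.leadingCoeff * q0.leadingCoeff)) := by
    have : ε = Polynomial.C ((-1) ^ r) := by simp [hε]
    rw [this, C2, Polynomial.coeff_C_mul, Polynomial.coeff_add, Polynomial.coeff_C_mul,
      hsq0 d0 (k + s) (by omega), hk, hs, Polynomial.coeff_mul_degree_add_degree, zero_add]
  rw [Polynomial.coeff_add, e1, e2] at hmain
  have h1 := hag (k + s - 1) (by omega)
  have h2 := hag (k + s) (by omega)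
  obtain ⟨x, hx⟩ := hd0
  obtain ⟨y, hy⟩ := hq0
  rw [hx, hy] at hmain
  have e3 : (2 * x + 1) * (2 * y + 1) = 2 * (2 * (x * y) + x + y) + 1 := by ring
  rw [e3] at hmain
  rcases neg_one_pow_eq_or ℤ r with e | e <;> rw [e] at hmain <;> omega
theorem exists_T {m : ℕ} (M : Matrix (Fin (m + 1)) (Fin (m + 1)) ℤ)
    (hM : ∀ i j, M i j = 1 ∨ M i j = -1) (hdiag : ∀ i, M i i = 1) (hsym : Mᵀ = M) :
    ∃ T : Polynomial ℤ, (∀ i, M.charpoly.coeff i * 2 ^ i = 2 ^ m * T.coeff i) ∧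
      (Odd m → (2 : Polynomial ℤ) ∣ T) ∧
      (Even m → ∃ q : Polynomial ℤ,
        (4 : Polynomial ℤ) ∣ T - (2 * Polynomial.X - 1) * ((-1) ^ (m / 2) * q ^ 2)) := by
  have hA : ∀ i j, ∃ a : ℤ, M i j = 1 - 2 * a := by
    intro i j
    rcases hM i j with h | h
    · exact ⟨0, by rw [h]; rfl⟩
    · exact ⟨1, by rw [h]; rfl⟩
  choose A hA using hA
  have hMs : ∀ i j, M i j = M j i := fun i j => by
    conv_lhs => rw [← hsym]
    rfl
  have hAs : ∀ i j, A i j = A j i := by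
    intro i j
    have := hMs i j
    rw [hA i j, hA j i] at this
    linarith
  have hAd : ∀ i, A i i = 0 := by
    intro i
    have := hdiag i
    rw [hA i i] at this
    linarith
  let y : Polynomial ℤ := Polynomial.X
  let c : ℤ →+* Polynomial ℤ := Polynomial.C
  -- the evaluated characteristic matrix
  let N : Matrix (Fin (m + 1)) (Fin (m + 1)) (Polynomial ℤ) :=
    of fun i j => (if i = j then 2 * y else 0) - (1 - 2 * c (A i j))
  have hN : M.charpoly.comp (Polynomial.C 2 * Polynomial.X) = N.det := by
    rw [Matrix.charpoly, ← Polynomial.coe_compRingHom_apply, RingHom.map_det]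
    congr 1
    ext1 i j
    simp only [RingHom.mapMatrix_apply, map_apply, Polynomial.coe_compRingHom_apply,
      charmatrix_apply, N, of_apply, Polynomial.sub_comp, Polynomial.C_comp, hA i j]
    by_cases h : i = j
    · subst h; simp [y, c]
    · simp [h, c]
  let S : Matrix (Fin m) (Fin m) (Polynomial ℤ) :=
    of fun i j => (if i = j then y else 0) + y
      + c (A i.succ j.succ) - c (A 0 j.succ) - c (A i.succ 0)
  let β : Fin m → Polynomial ℤ := fun j => c (A 0 j.succ) - y
  -- bordered matrices
  let Rm : Polynomial ℤ → Polynomial ℤ → Matrix (Fin (m + 1)) (Fin (m + 1)) (Polynomial ℤ) :=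
    fun z k => of (Fin.cons (Fin.cons z (fun j => k * β j)) (fun i => Fin.cons (β i) (S i)))
  have hRsub : ∀ z k, (Rm z k).submatrix Fin.succ Fin.succ = S := by
    intro z k; ext1 i j; simp [Rm]
  have hRdet : (Rm (2 * y - 1) 2).det = (2 * y - 1) * S.det + 2 * (Rm 0 1).det := by
    rw [det_succ_row_zero, det_succ_row_zero (Rm 0 1), Fin.sum_univ_succ, Fin.sum_univ_succ,
      mul_add, Finset.mul_sum]
    have e0 : ∀ z k, (Rm z k) 0 0 = z := fun z k => by simp [Rm]
    have e1 : ∀ z k (j : Fin m), (Rm z k) 0 j.succ = k * β j := fun z k j => by simp [Rm]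
    have e2 : ∀ z k z' k' (j : Fin (m + 1)), (Rm z k).submatrix Fin.succ j.succAbove
        = (Rm z' k').submatrix Fin.succ j.succAbove := by
      intro z k z' k' j; ext1 a b; simp [Rm]
    simp only [e0, e1, Fin.succAbove_zero, hRsub, e2 (2 * y - 1) 2 0 1]
    simp only [Fin.val_zero, pow_zero, one_mul, mul_zero, zero_mul, zero_add]
    congr 1
    refine Finset.sum_congr rfl fun j _ => ?_
    ring
  have hdetN : N.det = 2 ^ m * (Rm (2 * y - 1) 2).det := by
    -- row and column operations
    let N1 : Matrix (Fin (m + 1)) (Fin (m + 1)) (Polynomial ℤ) :=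
      of fun i j => N i j + (if i = 0 then 0 else -1) * N 0 j
    let N2 : Matrix (Fin (m + 1)) (Fin (m + 1)) (Polynomial ℤ) :=
      of fun i j => N1 j i + (if i = 0 then 0 else -1) * N1 j 0
    have h1 : N1.det = N.det :=
      det_eq_of_forall_row_eq_smul_add_const (fun i => if i = 0 then 0 else -1) 0 (by simp)
        (fun i j => rfl)
    have h2 : N2.det = N1ᵀ.det :=
      det_eq_of_forall_row_eq_smul_add_const (fun i => if i = 0 then 0 else -1) 0 (by simp)
        (fun i j => rfl)
    have h3 : N2ᵀ = of fun i j => (Fin.cons 1 (fun _ => 2) : Fin (m + 1) → Polynomial ℤ) i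
        * Rm (2 * y - 1) 2 i j := by
      ext1 i j
      rcases Fin.eq_zero_or_eq_succ i with rfl | ⟨i, rfl⟩ <;>
      rcases Fin.eq_zero_or_eq_succ j with rfl | ⟨j, rfl⟩
      · simp [N2, N1, N, Rm, hAd]
      · simp [N2, N1, N, Rm, hAd, β, (Fin.succ_ne_zero j).symm]
        ring
      · simp [N2, N1, N, Rm, hAd, β, hAs i.succ 0]
        ring
      · by_cases hij : i = j
        · subst hij
          simp [N2, N1, N, Rm, hAd, S, (Fin.succ_ne_zero i).symm]
          ring
        · simp [N2, N1, N, Rm, hAd, S, (Fin.succ_ne_zero j).symm, hij]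
          ring
    rw [← h1, ← det_transpose N1, ← h2, ← det_transpose N2, h3, det_mul_column, Fin.prod_univ_succ]
    simp
  have hSsym : Sᵀ = S := by
    ext1 i j
    simp only [S, transpose_apply, of_apply]
    rw [hAs j.succ i.succ, hAs 0 i.succ, hAs j.succ 0]
    by_cases hij : i = j
    · subst hij; ring
    · rw [if_neg hij, if_neg (Ne.symm hij)]; ring
  have hSd : ∀ i, (2 : Polynomial ℤ) ∣ S i i := by
    intro i
    refine ⟨y - c (A 0 i.succ), ?_⟩
    simp only [S, of_apply, hAd, hAs i.succ 0, if_true, map_zero]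
    ring
  refine ⟨(Rm (2 * y - 1) 2).det, ?_, ?_, ?_⟩
  · intro i
    have := congrArg (fun p => p.coeff i) (hN.trans hdetN)
    simp only [Polynomial.comp_C_mul_X_coeff] at this
    rw [this]
    have e : (2 : Polynomial ℤ) ^ m = Polynomial.C (2 ^ m) := by simp
    rw [e, Polynomial.coeff_C_mul]
  · intro hm
    rw [hRdet]
    exact dvd_add (Dvd.dvd.mul_left (two_dvd_det_odd S hSsym hSd (by simpa using hm)) _)
      (dvd_mul_right _ _)
  · rintro ⟨r, hr⟩
    have hR0 : (2 : Polynomial ℤ) ∣ (Rm 0 1).det := by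
      apply two_dvd_det_odd
      · ext1 i j
        rcases Fin.eq_zero_or_eq_succ i with rfl | ⟨i, rfl⟩ <;>
        rcases Fin.eq_zero_or_eq_succ j with rfl | ⟨j, rfl⟩
        · simp
        · simp [Rm]
        · simp [Rm]
        · simpa [Rm] using congrFun (congrFun hSsym i) j
      · intro i
        rcases Fin.eq_zero_or_eq_succ i with rfl | ⟨i, rfl⟩
        · simp [Rm]
        · simpa [Rm] using hSd i
      · rw [Fintype.card_fin]; exact ⟨r, by omega⟩
    have hm2 : m / 2 = r := by omega
    rw [hm2]
    have hq : ∃ q : Polynomial ℤ, (4 : Polynomial ℤ) ∣ S.det - (-1) ^ r * q ^ 2 := by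
      obtain rfl : m = 2 * r := by omega
      obtain ⟨h, f, hh, hf⟩ := det_even_sq prime_two_poly r S hSsym hSd
      exact exists_sqrt _ h f r hh hf
    obtain ⟨q, k, hk⟩ := hq
    obtain ⟨l, hl⟩ := hR0
    refine ⟨q, (2 * y - 1) * k + l, ?_⟩
    rw [hRdet, hl]
    have : S.det = (-1) ^ r * q ^ 2 + 4 * k := by linear_combination hk
    rw [this]
    simp only [y]
    ring

theorem coeff_two_zero {n : ℕ} (hn : 2 ≤ n) (M : Matrix (Fin n) (Fin n) ℤ)
    (hM : ∀ i j, M i j = 1 ∨ M i j = -1) (hdiag : ∀ i, M i i = 1) (hsym : Mᵀ = M) :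
    M.charpoly.coeff (n - 2) = 0 := by
  have hMs : ∀ i j, M i j = M j i := fun i j => by
    conv_lhs => rw [← hsym]
    rfl
  have := charpoly_coeff_eq_sum_minors M 2 (by simpa using hn)
  rw [Fintype.card_fin] at this
  rw [this, Finset.sum_eq_zero, mul_zero]
  intro s hs
  have hc : Fintype.card s = 2 := by simpa using (Finset.mem_powersetCard.1 hs).2
  let e : Fin 2 ≃ s := (Fintype.equivFinOfCardEq hc).symm
  rw [← det_submatrix_equiv_self e, det_fin_two]
  simp only [submatrix_apply, hdiag]
  rw [hMs (e 1) (e 0)]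
  rcases hM (e 0) (e 1) with h | h <;> rw [h] <;> norm_num

theorem card_bound {α : Type*} [DecidableEq α] [AddCommGroup α] : ∀ (k : ℕ)
    (V : Finset (Fin k → α)) (D : Fin k → Finset α) (N : Fin k → ℕ),
    (∀ i, (D i).card ≤ N i) →
    (∀ v ∈ V, ∀ w ∈ V, ∀ i, (∀ j, j < i → v j = w j) → v i - w i ∈ D i) →
    V.card ≤ ∏ i, N i := by
  intro k
  induction k with
  | zero =>
    intro V D N _ _
    simpa using Finset.card_le_one_of_subsingleton V
  | succ k ih =>
    intro V D N hD h
    rw [Fin.prod_univ_castSucc, mul_comm]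
    let f : (Fin (k + 1) → α) → (Fin k → α) := fun v => Fin.init v
    have h1 := ih (V.image f) (fun i => D i.castSucc) (fun i => N i.castSucc) (fun i => hD _) (by
      intro v hv w hw i hi
      obtain ⟨v', hv', rfl⟩ := Finset.mem_image.1 hv
      obtain ⟨w', hw', rfl⟩ := Finset.mem_image.1 hw
      refine h v' hv' w' hw' i.castSucc ?_
      intro j hj
      have hjk : (j : ℕ) < k := lt_trans (show (j : ℕ) < i from hj) i.2
      exact hi ⟨j, hjk⟩ hj)
    refine le_trans (Finset.card_le_mul_card_image (f := f) V (N (Fin.last k)) ?_)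
      (Nat.mul_le_mul_left _ h1)
    intro b hb
    obtain ⟨w, hw, rfl⟩ := Finset.mem_image.1 hb
    refine le_trans ?_ (hD (Fin.last k))
    refine Finset.card_le_card_of_injOn (fun v => v (Fin.last k) - w (Fin.last k)) ?_ ?_
    · intro v hv
      simp only [Finset.coe_filter, Set.mem_ofPred_eq] at hv
      refine h v hv.1 w hw _ ?_
      intro j hj
      exact congrFun hv.2 ⟨j, hj⟩
    · intro v hv v' hv' heq
      simp only [Finset.coe_filter, Set.mem_ofPred_eq] at hv hv'
      have heq' : v (Fin.last k) = v' (Fin.last k) := by simpa using heq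
      have hi : Fin.init v = Fin.init v' := hv.2.trans hv'.2.symm
      rw [← Fin.snoc_init_self v, ← Fin.snoc_init_self v', hi, heq']

/-- The admissible matrices. -/
def IsAdm {n : ℕ} (M : Matrix (Fin n) (Fin n) ℤ) : Prop :=
  (∀ i j, M i j = 1 ∨ M i j = -1) ∧ (∀ i, M i i = 1) ∧ Mᵀ = M

/-- The 2-adic exponent controlling the coordinate with index `j`. -/
def expo (e n j : ℕ) : ℕ :=
  if j = 0 then e else if j = 1 then (if Even n then 3 else 2) else j + 2

theorem expo_le (e n j : ℕ) (he : 3 ≤ e) (hj : j < e - 1) : expo e n j ≤ e := by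
  unfold expo
  split_ifs <;> omega

theorem sum_expo (e n : ℕ) (he : 3 ≤ e) :
    ∑ j ∈ Finset.range (e - 1), (e - expo e n j)
      = (e - 2).choose 2 + if Even n then 0 else 1 := by
  obtain ⟨k, rfl⟩ : ∃ k, e = k + 3 := ⟨e - 3, by omega⟩
  have h1 : k + 3 - 1 = k + 2 := by omega
  have h2 : k + 3 - 2 = k + 1 := by omega
  rw [h1, h2, Finset.sum_range_succ', Finset.sum_range_succ']
  have h3 : ∀ j ∈ Finset.range k, k + 3 - expo (k + 3) n (j + 1 + 1) = k - 1 - j := by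
    intro j hj
    simp only [expo]
    rw [if_neg (by omega), if_neg (by omega)]
    omega
  rw [Finset.sum_congr rfl h3, Finset.sum_range_reflect (fun j => j) k,
    Finset.sum_range_id, ← Nat.choose_two_right, Nat.choose_succ_succ' k 1]
  simp only [expo]
  split_ifs <;> simp_all <;> omega

theorem coeff_eq_T {m : ℕ} {p T : Polynomial ℤ}
    (h : ∀ i, p.coeff i * 2 ^ i = 2 ^ m * T.coeff i) (i : ℕ) (hi : i ≤ m) :
    p.coeff (m - i) = 2 ^ i * T.coeff (m - i) := by
  have h1 := h (m - i)
  have h2 : (2 : ℤ) ^ m = 2 ^ (m - i) * 2 ^ i := by rw [← pow_add]; congr 1; omega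
  rw [h2] at h1
  have h3 : (2 : ℤ) ^ (m - i) ≠ 0 := by positivity
  apply mul_left_cancel₀ h3
  linear_combination h1

theorem charpoly_coeff_pred {m : ℕ} {M : Matrix (Fin (m + 1)) (Fin (m + 1)) ℤ} (hM : IsAdm M) :
    M.charpoly.coeff m = -((m : ℤ) + 1) := by
  have := trace_eq_neg_charpoly_coeff M
  rw [Fintype.card_fin, Nat.add_sub_cancel] at this
  have h2 : M.trace = (m : ℤ) + 1 := by
    simp [Matrix.trace, hM.2.1]
  linarith

theorem charpoly_coeff_top {m : ℕ} (M : Matrix (Fin (m + 1)) (Fin (m + 1)) ℤ) :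
    M.charpoly.coeff (m + 1) = 1 := by
  have := M.charpoly_monic.coeff_natDegree
  rwa [M.charpoly_natDegree_eq_dim, Fintype.card_fin] at this

theorem charpoly_coeff_above {m : ℕ} (M : Matrix (Fin (m + 1)) (Fin (m + 1)) ℤ) (s : ℕ)
    (hs : m + 1 < s) : M.charpoly.coeff s = 0 := by
  apply Polynomial.coeff_eq_zero_of_natDegree_lt
  rwa [M.charpoly_natDegree_eq_dim, Fintype.card_fin]

theorem diff_dvd (e n : ℕ) (he : 3 ≤ e) (M M' : Matrix (Fin n) (Fin n) ℤ)
    (hM : IsAdm M) (hM' : IsAdm M') (j : ℕ) (hj : j < e - 1)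
    (hag : ∀ j' < j, (2 : ℤ) ^ e ∣
      M.charpoly.coeff (n - (j' + 2)) - M'.charpoly.coeff (n - (j' + 2))) :
    (2 : ℤ) ^ expo e n j ∣ M.charpoly.coeff (n - (j + 2)) - M'.charpoly.coeff (n - (j + 2)) := by
  by_cases hn : n ≤ 1
  · have : M = M' := by
      ext a b
      have hab : a = b := by ext; omega
      subst hab
      rw [hM.2.1, hM'.2.1]
    rw [this, sub_self]
    exact dvd_zero _
  push Not at hn
  by_cases hj0 : j = 0
  · subst hj0
    rw [zero_add, coeff_two_zero hn M hM.1 hM.2.1 hM.2.2,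
      coeff_two_zero hn M' hM'.1 hM'.2.1 hM'.2.2, sub_self]
    exact dvd_zero _
  by_cases hjn : n < j + 2
  · have h1 := hag (j - 1) (by omega)
    have h2 : n - (j + 2) = n - (j - 1 + 2) := by omega
    rw [h2]
    exact (pow_dvd_pow 2 (expo_le e n j he hj)).trans h1
  push Not at hjn
  obtain ⟨m, rfl⟩ : ∃ m, n = m + 1 := ⟨n - 1, by omega⟩
  obtain ⟨T, hT, hTe, hTo⟩ := exists_T M hM.1 hM.2.1 hM.2.2
  obtain ⟨T', hT', hTe', hTo'⟩ := exists_T M' hM'.1 hM'.2.1 hM'.2.2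
  have hco : ∀ j, j + 2 ≤ m + 1 →
      M.charpoly.coeff (m + 1 - (j + 2)) - M'.charpoly.coeff (m + 1 - (j + 2))
        = 2 ^ (j + 1) * (T.coeff (m + 1 - (j + 2)) - T'.coeff (m + 1 - (j + 2))) := by
    intro j hj
    have h0 : m + 1 - (j + 2) = m - (j + 1) := by omega
    rw [h0, coeff_eq_T hT (j + 1) (by omega), coeff_eq_T hT' (j + 1) (by omega)]
    ring
  have C2 : (2 : Polynomial ℤ) = Polynomial.C 2 := by simp
  rw [hco j hjn]
  -- it suffices to have parity
  have hfin : (2 : ℤ) ∣ T.coeff (m + 1 - (j + 2)) - T'.coeff (m + 1 - (j + 2)) →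
      (2 : ℤ) ^ (j + 2) ∣ 2 ^ (j + 1) * (T.coeff (m + 1 - (j + 2)) - T'.coeff (m + 1 - (j + 2))) := by
    intro h
    rw [pow_succ]
    exact mul_dvd_mul_left _ h
  by_cases hev : Even (m + 1)
  · have hx : expo e (m + 1) j = j + 2 := by
      unfold expo
      rw [if_neg hj0, if_pos hev]
      split_ifs <;> omega
    rw [hx]
    apply hfin
    have hm : Odd m := by
      rw [← Nat.not_even_iff_odd]
      exact fun h => (Nat.even_add_one.1 hev) h
    apply dvd_sub
    · exact coeff_dvd_of_dvd (C2 ▸ hTe hm) _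
    · exact coeff_dvd_of_dvd (C2 ▸ hTe' hm) _
  have hm : Even m := by
    by_contra h
    exact hev (Nat.even_add_one.2 h)
  by_cases hj1 : j = 1
  · subst hj1
    have hx : expo e (m + 1) 1 = 2 := by
      unfold expo
      rw [if_neg hj0, if_pos rfl, if_neg hev]
    rw [hx]
    exact dvd_mul_right _ _
  have hx : expo e (m + 1) j = j + 2 := by
    unfold expo
    rw [if_neg hj0, if_neg hj1]
  rw [hx]
  apply hfin
  obtain ⟨q, hq⟩ := hTo hm
  obtain ⟨q', hq'⟩ := hTo' hm
  have hTm : T.coeff m = -((m : ℤ) + 1) := by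
    have := coeff_eq_T hT 0 (Nat.zero_le m)
    rw [Nat.sub_zero, charpoly_coeff_pred hM] at this
    linarith
  have hTm' : T'.coeff m = -((m : ℤ) + 1) := by
    have := coeff_eq_T hT' 0 (Nat.zero_le m)
    rw [Nat.sub_zero, charpoly_coeff_pred hM'] at this
    linarith
  have hpos : (2 : ℤ) ^ m ≠ 0 := by positivity
  have htop : ∀ (M : Matrix (Fin (m + 1)) (Fin (m + 1)) ℤ) (T : Polynomial ℤ),
      (∀ i, M.charpoly.coeff i * 2 ^ i = 2 ^ m * T.coeff i) → T.coeff (m + 1) = 2 := by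
    intro M T hT
    have := hT (m + 1)
    rw [charpoly_coeff_top, pow_succ] at this
    apply mul_left_cancel₀ hpos
    linarith
  have habove : ∀ (M : Matrix (Fin (m + 1)) (Fin (m + 1)) ℤ) (T : Polynomial ℤ),
      (∀ i, M.charpoly.coeff i * 2 ^ i = 2 ^ m * T.coeff i) →
      ∀ s, m + 1 < s → T.coeff s = 0 := by
    intro M T hT s hs
    have := hT s
    rw [charpoly_coeff_above M s hs, zero_mul] at this
    exact (mul_eq_zero.1 this.symm).resolve_left hpos
  refine poly_key T T' q q' (m / 2) (m + 1) (m + 1 - (j + 2)) hq hq' ?_ ?_ (by omega) ?_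
  · rw [Nat.add_sub_cancel, hTm']
    have : Odd ((m + 1 : ℕ) : ℤ) := by
      rw [Int.odd_coe_nat]
      exact Nat.not_even_iff_odd.1 hev
    push_cast at this
    exact this.neg
  · intro s hs
    rcases hs.lt_or_eq with h | rfl
    · rw [habove M' T' hT' s h]
      exact dvd_zero _
    · rw [htop M' T' hT']
  · intro s hs
    rcases lt_trichotomy s (m + 1) with h | rfl | h
    · by_cases hsm : s = m
      · subst hsm
        rw [hTm, hTm', sub_self]
        exact dvd_zero _
      · obtain ⟨j', rfl⟩ : ∃ j', s = m + 1 - (j' + 2) := ⟨m + 1 - s - 2, by omega⟩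
        have h1 := hag (m + 1 - (m + 1 - (j' + 2)) - 2) (by omega)
        have h0 : m + 1 - (m + 1 - (m + 1 - (j' + 2)) - 2 + 2) = m + 1 - (j' + 2) := by omega
        set j'' := m + 1 - (m + 1 - (j' + 2)) - 2 with hj''
        rw [hco j'' (by omega), h0] at h1
        have h2 : (2 : ℤ) ^ (j'' + 1) * 4 ∣ 2 ^ e := by
          have : (2 : ℤ) ^ (j'' + 1) * 4 = 2 ^ (j'' + 3) := by ring
          rw [this]
          exact pow_dvd_pow _ (by omega)
        exact Int.dvd_of_mul_dvd_mul_left (by positivity) (h2.trans h1)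
    · rw [htop M T hT, htop M' T' hT', sub_self]
      exact dvd_zero _
    · rw [habove M T hT s h, habove M' T' hT' s h, sub_self]
      exact dvd_zero _

/-- Multiples of `2 ^ x` in `ZMod (2 ^ e)`. -/
def multSet (e x : ℕ) : Finset (ZMod (2 ^ e)) :=
  (Finset.range (2 ^ (e - x))).image (fun t : ℕ => ((2 ^ x * t : ℤ) : ZMod (2 ^ e)))

theorem mem_multSet (e x : ℕ) (hx : x ≤ e) (a : ℤ) (ha : (2 : ℤ) ^ x ∣ a) :
    (a : ZMod (2 ^ e)) ∈ multSet e x := by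
  obtain ⟨z, rfl⟩ := ha
  have hpos : (0 : ℤ) < 2 ^ (e - x) := by positivity
  refine Finset.mem_image.2 ⟨(z % 2 ^ (e - x)).toNat, ?_, ?_⟩
  · rw [Finset.mem_range]
    have h1 := Int.emod_lt_of_pos z hpos
    have h0 := Int.emod_nonneg z hpos.ne'
    zify
    rw [Int.toNat_of_nonneg h0]
    exact h1
  · have h0 := Int.emod_nonneg z hpos.ne'
    rw [Int.toNat_of_nonneg h0, ZMod.intCast_eq_intCast_iff_dvd_sub]
    have h2 : z - z % 2 ^ (e - x) = 2 ^ (e - x) * (z / 2 ^ (e - x)) := by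
      have := Int.emod_add_mul_ediv z (2 ^ (e - x))
      linarith
    rw [← mul_sub, h2, ← mul_assoc, ← pow_add]
    have h3 : x + (e - x) = e := by omega
    rw [h3]
    push_cast
    exact dvd_mul_right _ _

open Matrix

/-- Greaves–Yatsyna upper bound: for `e ≥ 3`, the number of distinct
tuples `(a₂ mod 2^e, …, a_e mod 2^e)` of characteristic polynomial coefficients of
symmetric `n×n` `{±1}`-matrices with unit diagonal is at most `2^C(e-2,2)` for even
`n`, and at most `2^(C(e-2,2)+1)` for odd `n`. -/
theorem stmt18 (e n : ℕ) (he : 3 ≤ e) :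
    Set.ncard
      {v : Fin (e - 1) → ZMod (2 ^ e) |
        ∃ M : Matrix (Fin n) (Fin n) ℤ,
          (∀ i j, M i j = 1 ∨ M i j = -1) ∧ (∀ i, M i i = 1) ∧ Mᵀ = M ∧
          ∀ j : Fin (e - 1),
            v j = ((M.charpoly.coeff (n - (j.val + 2)) : ℤ) : ZMod (2 ^ e))} ≤
      if Even n then 2 ^ ((e - 2).choose 2) else 2 ^ ((e - 2).choose 2 + 1) := by
  haveI : NeZero (2 ^ e) := ⟨by positivity⟩
  set V := {v : Fin (e - 1) → ZMod (2 ^ e) |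
        ∃ M : Matrix (Fin n) (Fin n) ℤ,
          (∀ i j, M i j = 1 ∨ M i j = -1) ∧ (∀ i, M i i = 1) ∧ Mᵀ = M ∧
          ∀ j : Fin (e - 1),
            v j = ((M.charpoly.coeff (n - (j.val + 2)) : ℤ) : ZMod (2 ^ e))} with hV
  rw [Set.ncard_eq_toFinset_card V (Set.toFinite V)]
  have key := card_bound (e - 1) (Set.toFinite V).toFinset (fun j => multSet e (expo e n j))
    (fun j => 2 ^ (e - expo e n j))
    (fun j => by
      refine le_trans Finset.card_image_le ?_
      rw [Finset.card_range])
    (by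
      intro v hv w hw j hag
      rw [Set.Finite.mem_toFinset] at hv hw
      obtain ⟨M, h1, h2, h3, hv⟩ := hv
      obtain ⟨M', h1', h2', h3', hw⟩ := hw
      rw [hv, hw, ← Int.cast_sub]
      refine mem_multSet e _ (expo_le e n j he j.2) _ ?_
      refine diff_dvd e n he M M' ⟨h1, h2, h3⟩ ⟨h1', h2', h3'⟩ j j.2 ?_
      intro j' hj'
      have := hag ⟨j', hj'.trans j.2⟩ hj'
      rw [hv, hw, eq_comm, ZMod.intCast_eq_intCast_iff_dvd_sub] at this
      simpa using this)
  refine key.trans (le_of_eq ?_)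
  rw [Fin.prod_univ_eq_prod_range (fun j => 2 ^ (e - expo e n j)) (e - 1),
    Finset.prod_pow_eq_pow_sum, sum_expo e n he]
  split_ifs <;> rfl
end

section
/- Let e ≥ 4 and n ∈ ℕ, and let T_n denote the set of n×n {±1}-matrices M with unit diagonal such that M - I is skew-symmetric. Then the number of tuples (a₂ mod 2^e, ..., a_e mod 2^e) arising from characteristic polynomials det(xI-M) = Σ a_i x^{n-i} with M ∈ T_n is at most 2^{⌊(e-1)/2⌋·⌊(e-2)/2⌋} if n is even, and at most 2^{⌊(e-2)/2⌋·⌊(e-3)/2⌋} if n is odd. -/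
open Matrix

namespace Skew19

/-- the class `T_n` -/
def T (n : ℕ) (M : Matrix (Fin n) (Fin n) ℤ) : Prop :=
  (∀ i j, M i j = 1 ∨ M i j = -1) ∧ (∀ i, M i i = 1) ∧ (M - 1)ᵀ = -(M - 1)

lemma dvd_det {ι : Type*} [Fintype ι] [DecidableEq ι] (A : Matrix ι ι ℤ)
    (h : ∀ i j, A i j = 1 ∨ A i j = -1) : (2 : ℤ) ^ (Fintype.card ι - 1) ∣ A.det := by
  rcases isEmpty_or_nonempty ι with hi | ⟨⟨k⟩⟩
  · simp
  · have h2 : ∀ i j, ∃ b : ℤ, A i j - A k j = 2 * b := by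
      intro i j
      rcases h i j with h1 | h1 <;> rcases h k j with h2 | h2 <;> rw [h1, h2]
      · exact ⟨0, by norm_num⟩
      · exact ⟨1, by norm_num⟩
      · exact ⟨-1, by norm_num⟩
      · exact ⟨0, by norm_num⟩
    choose b hb using h2
    let v : ι → ℤ := fun i => if i = k then 1 else 2
    let B : Matrix ι ι ℤ := fun i j => if i = k then A k j else b i j
    have h3 : A.det = (Matrix.of fun i j => v i * B i j).det := by
      refine det_eq_of_forall_row_eq_smul_add_const (fun i => if i = k then 0 else 1) k (by simp) ?_
      intro i j
      by_cases hik : i = k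
      · simp [v, B, hik]
      · have := hb i j
        simp [v, B, hik]
        linarith
    rw [h3, det_mul_column]
    apply Dvd.dvd.mul_right
    have : ∏ i, v i = 2 ^ (Fintype.card ι - 1) := by
      simp only [v]
      rw [Finset.prod_ite]
      simp [Finset.filter_ne', Finset.card_univ]
    rw [this]

lemma dvd_coeff {n : ℕ} {M : Matrix (Fin n) (Fin n) ℤ} (hM : T n M) (k : ℕ) (hk : k ≤ n) :
    (2 : ℤ) ^ (k - 1) ∣ M.charpoly.coeff (n - k) := by
  have := M.charpoly_coeff_eq_sum_minors k (by simpa using hk)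
  rw [Fintype.card_fin] at this
  rw [this]
  apply Dvd.dvd.mul_left
  apply Finset.dvd_sum
  intro s hs
  have := dvd_det (M.submatrix (Subtype.val : s → Fin n) (Subtype.val : s → Fin n))
    (fun i j => hM.1 _ _)
  rwa [Fintype.card_coe, (Finset.mem_powersetCard.mp hs).2] at this

lemma skew {n : ℕ} {M : Matrix (Fin n) (Fin n) ℤ} (hM : T n M) (i j : Fin n) (hij : i ≠ j) :
    M j i = - M i j := by
  have := congrFun (congrFun hM.2.2 i) j
  simp only [transpose_apply, Matrix.sub_apply, Matrix.neg_apply, one_apply_ne hij, one_apply_ne hij.symm] at this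
  linarith

lemma coeff_small {n : ℕ} {M M' : Matrix (Fin n) (Fin n) ℤ} (hM : T n M) (hM' : T n M')
    (k : ℕ) (hk : k ≤ n) (hk2 : k ≤ 2) :
    M.charpoly.coeff (n - k) = M'.charpoly.coeff (n - k) := by
  have h1 := M.charpoly_coeff_eq_sum_minors k (by simpa using hk)
  have h2 := M'.charpoly_coeff_eq_sum_minors k (by simpa using hk)
  rw [Fintype.card_fin] at h1 h2
  rw [h1, h2]
  congr 1
  apply Finset.sum_congr rfl
  intro s hs
  have hs := (Finset.mem_powersetCard.mp hs).2
  have key : ∀ N : Matrix (Fin n) (Fin n) ℤ, T n N →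
      (N.submatrix (Subtype.val : s → Fin n) (Subtype.val : s → Fin n)).det = 
        if k = 2 then 2 else 1 := by
    intro N hN
    have e : Fin k ≃ s := (Fintype.equivFinOfCardEq (by simpa using hs)).symm
    rw [← det_submatrix_equiv_self e]
    interval_cases k
    · simp
    · simp [hN.2.1]
    · rw [det_fin_two]
      have hne : ((e 0 : s) : Fin n) ≠ (e 1 : s) := by
        intro h
        have := e.injective (Subtype.ext h)
        simp at this
      simp only [submatrix_apply, hN.2.1, skew hN _ _ hne]
      rcases hN.1 (e 0) (e 1) with h | h <;> rw [h] <;> norm_num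
  rw [key M hM, key M' hM']

lemma skew_coeff {n : ℕ} (S : Matrix (Fin n) (Fin n) ℤ) (hS : Sᵀ = -S) (k : ℕ) (hk : k ≤ n)
    (hodd : Odd k) : S.charpoly.coeff (n - k) = 0 := by
  have h1 := S.charpoly_coeff_eq_sum_minors k (by simpa using hk)
  rw [Fintype.card_fin] at h1
  rw [h1, Finset.sum_eq_zero, mul_zero]
  intro s hs
  have hs := (Finset.mem_powersetCard.mp hs).2
  set B := S.submatrix (Subtype.val : s → Fin n) (Subtype.val : s → Fin n) with hB
  have hBt : Bᵀ = -B := by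
    rw [hB, transpose_submatrix, hS]; rfl
  have := det_transpose B
  rw [hBt, det_neg, Fintype.card_coe, hs, hodd.neg_one_pow] at this
  linarith

lemma relation {n : ℕ} {M : Matrix (Fin n) (Fin n) ℤ} (hM : T n M) (k : ℕ) (hk : k ≤ n)
    (hodd : Odd k) :
    ∑ i ∈ Finset.range (k + 1), ((n - i).choose (n - k) : ℤ) * M.charpoly.coeff (n - i) = 0 := by
  have h := skew_coeff (M - 1) hM.2.2 k hk hodd
  have h1 := charpoly_sub_scalar M 1
  rw [map_one] at h1
  rw [h1, ← Polynomial.taylor_apply, Polynomial.taylor_coeff,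
    Polynomial.eval_eq_sum_range' (n := k + 1)] at h
  · rw [← Finset.sum_range_reflect] at h
    rw [← h]
    apply Finset.sum_congr rfl
    intro i hi
    have hi := Finset.mem_range.mp hi
    rw [Polynomial.hasseDeriv_coeff, show k + 1 - 1 - i + (n - k) = n - i by omega]
    simp
  · have := Polynomial.natDegree_hasseDeriv_le M.charpoly (n - k)
    rw [charpoly_natDegree_eq_dim, Fintype.card_fin] at this
    omega

/-- exponent of determinacy -/
def d (e n k : ℕ) : ℕ :=
  if k < 4 ∨ Odd k then e else if Even n then k - 1 else k

lemma step {e n : ℕ} {M M' : Matrix (Fin n) (Fin n) ℤ} (hM : T n M) (hM' : T n M')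
    (k : ℕ) (hke : k ≤ e)
    (h : ∀ i < k, (2 : ℤ) ^ e ∣ M.charpoly.coeff (n - i) - M'.charpoly.coeff (n - i)) :
    (2 : ℤ) ^ d e n k ∣ M.charpoly.coeff (n - k) - M'.charpoly.coeff (n - k) := by
  have hde : d e n k ≤ e := by unfold d; split_ifs <;> omega
  rcases lt_or_ge n k with hnk | hnk
  · have := h n hnk
    rw [show n - k = n - n by omega]
    exact (pow_dvd_pow _ hde).trans this
  have sumrel : ∀ m, m ≤ n → Odd m → ∑ i ∈ Finset.range (m + 1), ((n - i).choose (n - m) : ℤ) *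
      (M.charpoly.coeff (n - i) - M'.charpoly.coeff (n - i)) = 0 := by
    intro m hm ho
    simp only [mul_sub, Finset.sum_sub_distrib]
    rw [relation hM m hm ho, relation hM' m hm ho, sub_zero]
  have sumdvd : ∀ m, (2 : ℤ) ^ e ∣ ∑ i ∈ Finset.range k, ((n - i).choose (n - m) : ℤ) *
      (M.charpoly.coeff (n - i) - M'.charpoly.coeff (n - i)) := fun m =>
    Finset.dvd_sum fun i hi => (h i (Finset.mem_range.mp hi)).mul_left _
  by_cases ho : Odd k
  · have h1 := sumrel k hnk ho
    rw [Finset.sum_range_succ, Nat.choose_self, Nat.cast_one, one_mul] at h1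
    have : d e n k = e := by simp [d, ho]
    rw [this]
    exact (dvd_add_right (sumdvd k)).mp (h1 ▸ dvd_zero _)
  by_cases h2 : k ≤ 2
  · rw [coeff_small hM hM' k hnk h2]; simp
  have h4 : ¬ (k < 4) := by
    intro h4
    have : k = 3 := by omega
    subst this
    exact ho (by decide)
  by_cases hn : Even n
  · have : d e n k = k - 1 := by simp [d, ho, h4, hn]
    rw [this]
    exact dvd_sub (dvd_coeff hM k hnk) (dvd_coeff hM' k hnk)
  · have hd : d e n k = k := by simp [d, ho, h4, hn]
    rw [hd]
    have hke' : Even k := Nat.not_odd_iff_even.mp ho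
    have hn' : Odd n := Nat.not_even_iff_odd.mp hn
    have hlt : k + 1 ≤ n := by
      rcases hnk.lt_or_eq with h | h
      · omega
      · exact absurd (h ▸ hke') hn
    have h1 := sumrel (k + 1) hlt hke'.add_one
    rw [Finset.sum_range_succ, Finset.sum_range_succ, Nat.choose_self, Nat.cast_one, one_mul,
      add_assoc] at h1
    have hA := (pow_dvd_pow (2 : ℤ) hke).trans (sumdvd (k + 1))
    have hB := (dvd_add_right hA).mp (h1 ▸ dvd_zero _)
    have hC : (2 : ℤ) ^ k ∣ M.charpoly.coeff (n - (k + 1)) - M'.charpoly.coeff (n - (k + 1)) :=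
      dvd_sub (dvd_coeff hM (k + 1) hlt) (dvd_coeff hM' (k + 1) hlt)
    have hD := (dvd_add_left hC).mp hB
    have hch : (n - k).choose (n - (k + 1)) = n - k := by
      rw [← Nat.choose_symm (by omega), show n - k - (n - (k + 1)) = 1 by omega, Nat.choose_one_right]
    rw [hch] at hD
    refine IsCoprime.dvd_of_dvd_mul_left ?_ hD
    apply IsCoprime.pow_left
    have : Odd (n - k) := Nat.Odd.sub_even hnk hn' hke'
    have := (Nat.coprime_two_left.mpr this).isCoprime
    exact_mod_cast this

lemma count {α R : Type*} [AddCommGroup R] [Finite R] (S : Set α) (f : ℕ → α → R)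
    (D : ℕ → Set R) (m : ℕ)
    (h : ∀ k < m, ∀ x ∈ S, ∀ y ∈ S, (∀ i < k, f i x = f i y) → f k x - f k y ∈ D k) :
    Set.ncard ((fun x => fun i : Fin m => f i x) '' S) ≤ ∏ k ∈ Finset.range m, (D k).ncard := by
  induction m with
  | zero =>
    simp only [Finset.range_zero, Finset.prod_empty]
    exact Set.ncard_le_one_of_subsingleton _
  | succ m ih =>
    have ih := ih (fun k hk => h k (by omega))
    rw [Finset.prod_range_succ]
    refine le_trans ?_ (Nat.mul_le_mul_right _ ih)
    rw [← Set.ncard_prod]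
    classical
    set P : α → (Fin m → R) := fun x i => f i x with hP
    have hex : ∀ w : Fin m → R, ∃ r : R, ∀ x ∈ S, P x = w → f m x - r ∈ D m := by
      intro w
      by_cases hw : ∃ y ∈ S, P y = w
      · obtain ⟨y, hy, hyw⟩ := hw
        refine ⟨f m y, fun x hx hxw => h m (by omega) x hx y hy fun i hi => ?_⟩
        exact congrFun (hxw.trans hyw.symm) ⟨i, hi⟩
      · exact ⟨0, fun x hx hxw => absurd ⟨x, hx, hxw⟩ hw⟩
    choose r hr using hex
    refine Set.ncard_le_ncard_of_injOn
      (fun v : Fin (m + 1) → R =>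
        ((fun i : Fin m => v i.castSucc), v (Fin.last m) - r (fun i : Fin m => v i.castSucc)))
      ?_ ?_ (Set.toFinite _)
    · rintro _ ⟨x, hx, rfl⟩
      exact ⟨⟨x, hx, rfl⟩, hr _ x hx rfl⟩
    · intro v _ w _ hvw
      simp only [Prod.mk.injEq] at hvw
      obtain ⟨h1, h2⟩ := hvw
      rw [h1] at h2
      funext i
      refine Fin.lastCases ?_ (fun i => ?_) i
      · exact sub_left_injective h2
      · exact congrFun h1 i

lemma card_mult (e d : ℕ) (hd : d ≤ e) :
    Set.ncard {z : ZMod (2 ^ e) | ∃ t : ℤ, z = ((2 ^ d * t : ℤ) : ZMod (2 ^ e))} ≤ 2 ^ (e - d) := by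
  have hsub : {z : ZMod (2 ^ e) | ∃ t : ℤ, z = ((2 ^ d * t : ℤ) : ZMod (2 ^ e))} ⊆
      ((Finset.range (2 ^ (e - d))).image
        (fun s : ℕ => ((2 ^ d * (s : ℤ) : ℤ) : ZMod (2 ^ e))) : Finset (ZMod (2 ^ e))) := by
    rintro z ⟨t, rfl⟩
    have hpos : (0 : ℤ) < 2 ^ (e - d) := by positivity
    simp only [Finset.coe_image, Set.mem_image, Finset.mem_coe, Finset.mem_range]
    have h0 := Int.emod_nonneg t hpos.ne'
    have h1 := Int.emod_lt_of_pos t hpos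
    refine ⟨(t % 2 ^ (e - d)).toNat, ?_, ?_⟩
    · zify; rw [Int.toNat_of_nonneg h0]; exact h1
    · rw [Int.toNat_of_nonneg h0, ZMod.intCast_eq_intCast_iff_dvd_sub]
      refine ⟨t / 2 ^ (e - d), ?_⟩
      have h2 := Int.emod_add_mul_ediv t (2 ^ (e - d))
      have h3 : (2 : ℤ) ^ e = 2 ^ d * 2 ^ (e - d) := by rw [← pow_add]; congr 1; omega
      push_cast
      rw [h3]
      linear_combination (-(2 : ℤ) ^ d) * h2
  refine (Set.ncard_le_ncard hsub (Finset.finite_toSet _)).trans ?_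
  rw [Set.ncard_coe_finset]
  exact Finset.card_image_le.trans (by simp)

lemma sum_d_aux (e n s : ℕ) (hs : 2 * s + 4 ≤ e) :
    ∑ k ∈ Finset.range (2 * s + 5), (e - d e n k) =
      (s + 1) * (if Even n then e - 3 - s else e - 4 - s) := by
  induction s with
  | zero =>
    have h4 : d e n 4 = if Even n then 3 else 4 := by
      have : ¬ Odd 4 := by decide
      simp [d, this]
    have h0 : ∀ k < 4, d e n k = e := fun k hk => by simp [d, hk]
    simp only [Nat.mul_zero, Nat.zero_add, Finset.sum_range_succ, Finset.sum_range_zero, h4,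
      h0 0 (by omega), h0 1 (by omega), h0 2 (by omega), h0 3 (by omega)]
    split_ifs <;> omega
  | succ s ih =>
    rw [show 2 * (s + 1) + 5 = (2 * s + 5) + 1 + 1 by ring, Finset.sum_range_succ,
      Finset.sum_range_succ, ih (by omega)]
    have h1 : d e n (2 * s + 5) = e := by
      have : Odd (2 * s + 5) := ⟨s + 2, by ring⟩
      simp [d, this]
    have h2 : d e n (2 * s + 5 + 1) = if Even n then 2 * s + 5 else 2 * s + 6 := by
      have : ¬ Odd (2 * s + 5 + 1) := by rw [Nat.not_odd_iff_even]; exact ⟨s + 3, by ring⟩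
      simp [d, this]
    rw [h1, h2]
    obtain ⟨c, rfl⟩ : ∃ c, e = 2 * (s + 1) + 4 + c := ⟨e - (2 * (s + 1) + 4), by omega⟩
    split_ifs
    · rw [show 2 * (s + 1) + 4 + c - 3 - s = s + 3 + c by omega,
        show 2 * (s + 1) + 4 + c - (2 * s + 5) = c + 1 by omega,
        show 2 * (s + 1) + 4 + c - 3 - (s + 1) = s + 2 + c by omega]
      simp
      ring
    · rw [show 2 * (s + 1) + 4 + c - 4 - s = s + 2 + c by omega,
        show 2 * (s + 1) + 4 + c - (2 * s + 6) = c by omega,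
        show 2 * (s + 1) + 4 + c - 4 - (s + 1) = s + 1 + c by omega]
      simp
      ring

lemma sum_d (e n : ℕ) (he : 4 ≤ e) :
    ∑ k ∈ Finset.range (e + 1), (e - d e n k) =
      if Even n then ((e - 1) / 2) * ((e - 2) / 2) else ((e - 2) / 2) * ((e - 3) / 2) := by
  obtain ⟨t, ht | ht⟩ : ∃ t, e = 2 * t + 4 ∨ e = 2 * t + 5 := ⟨(e - 4) / 2, by omega⟩
  · rw [show e + 1 = 2 * t + 5 by omega, sum_d_aux e n t (by omega),
      show (e - 1) / 2 = t + 1 by omega, show (e - 2) / 2 = t + 1 by omega,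
      show (e - 3) / 2 = t by omega, show e - 3 - t = t + 1 by omega,
      show e - 4 - t = t by omega]
    split_ifs <;> rfl
  · have h1 : d e n (2 * t + 5) = e := by
      have : Odd (2 * t + 5) := ⟨t + 2, by ring⟩
      simp [d, this]
    rw [show e + 1 = 2 * t + 5 + 1 by omega, Finset.sum_range_succ, sum_d_aux e n t (by omega), h1,
      show (e - 1) / 2 = t + 2 by omega, show (e - 2) / 2 = t + 1 by omega,
      show (e - 3) / 2 = t + 1 by omega, show e - 3 - t = t + 2 by omega,
      show e - 4 - t = t + 1 by omega]
    split_ifs <;> simp <;> ring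

end Skew19

/-- for `e ≥ 4`, the number of distinct tuples
`(a₂ mod 2^e, …, a_e mod 2^e)` of characteristic polynomial coefficients of `n×n`
`{±1}`-matrices `M` with unit diagonal and `M - I` skew-symmetric is at most
`2^(⌊(e-1)/2⌋·⌊(e-2)/2⌋)` for even `n`, and at most `2^(⌊(e-2)/2⌋·⌊(e-3)/2⌋)` for
odd `n`. -/
theorem stmt19 (e n : ℕ) (he : 4 ≤ e) :
    Set.ncard
      {v : Fin (e - 1) → ZMod (2 ^ e) |
        ∃ M : Matrix (Fin n) (Fin n) ℤ,
          (∀ i j, M i j = 1 ∨ M i j = -1) ∧ (∀ i, M i i = 1) ∧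
          (M - 1)ᵀ = -(M - 1) ∧
          ∀ j : Fin (e - 1),
            v j = ((M.charpoly.coeff (n - (j.val + 2)) : ℤ) : ZMod (2 ^ e))} ≤
      if Even n then 2 ^ (((e - 1) / 2) * ((e - 2) / 2))
      else 2 ^ (((e - 2) / 2) * ((e - 3) / 2)) := by
  have hfin : NeZero (2 ^ e) := ⟨by positivity⟩
  let f : ℕ → Matrix (Fin n) (Fin n) ℤ → ZMod (2 ^ e) :=
    fun k M => ((M.charpoly.coeff (n - k) : ℤ) : ZMod (2 ^ e))
  have hde : ∀ k ∈ Finset.range (e + 1), Skew19.d e n k ≤ e := by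
    intro k hk
    have := Finset.mem_range.mp hk
    unfold Skew19.d
    split_ifs <;> omega
  have hcount := Skew19.count {M | Skew19.T n M} f
    (fun k => {z : ZMod (2 ^ e) | ∃ t : ℤ, z = ((2 ^ Skew19.d e n k * t : ℤ) : ZMod (2 ^ e))})
    (e + 1) (by
      intro k hk M hM M' hM' h
      obtain ⟨t, ht⟩ := Skew19.step (e := e) hM hM' k (by omega) (by
        intro i hi
        have := (h i hi).symm
        simp only [f] at this
        rw [ZMod.intCast_eq_intCast_iff_dvd_sub] at this
        exact_mod_cast this)
      refine ⟨t, ?_⟩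
      rw [← ht]
      simp [f])
  have hprod : ∏ k ∈ Finset.range (e + 1), Set.ncard
      {z : ZMod (2 ^ e) | ∃ t : ℤ, z = ((2 ^ Skew19.d e n k * t : ℤ) : ZMod (2 ^ e))} ≤
      2 ^ ∑ k ∈ Finset.range (e + 1), (e - Skew19.d e n k) := by
    rw [← Finset.prod_pow_eq_pow_sum]
    exact Finset.prod_le_prod' fun k hk => Skew19.card_mult e _ (hde k hk)
  rw [Skew19.sum_d e n he] at hprod
  have hgoal := hcount.trans hprod
  rw [apply_ite (fun m => 2 ^ m)] at hgoal
  refine le_trans ?_ hgoal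
  let g : (Fin (e + 1) → ZMod (2 ^ e)) → (Fin (e - 1) → ZMod (2 ^ e)) :=
    fun w j => w ⟨j.val + 2, by omega⟩
  refine le_trans (Set.ncard_le_ncard (t := g '' _) ?_ (Set.toFinite _))
    (Set.ncard_image_le (f := g) (Set.toFinite _))
  rintro v ⟨M, h1, h2, h3, h4⟩
  refine ⟨_, ⟨M, ⟨h1, h2, h3⟩, rfl⟩, ?_⟩
  funext j
  rw [h4 j]
end
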